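/- (Proposition 4, first part.) With the step weight functions ω_n and solutions W_n as in the context, one has W_0(x,y) = W^{(p_0)}(x−y) for all x, y ∈ ℝ, and for every n ≥ 0 and all x, y ∈ ℝ with x ≥ y: W_{n+1}(x,y) = W_n(x,y) + (p_{n+1} − p_n) ∫_y^{a_{n+1}} W_n(x,z) W^{(p_{n+1})}(z−y) dz, where for y > a_{n+1} the integral ∫_y^{a_{n+1}} is interpreted as −∫_{a_{n+1}}^y. -/

import Mathlib

open MeasureTheory Set

noncomputable section

/-- A real-valued function is locally bounded if it is bounded on every compact set. -/
def LocBdd {α : Type*} [TopologicalSpace α] (f : α → ℝ) : Prop :=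
  ∀ K : Set α, IsCompact K → ∃ C : ℝ, ∀ x ∈ K, |f x| ≤ C

namespace LocBdd

variable {α β : Type*} [TopologicalSpace α] [TopologicalSpace β] {f g : α → ℝ}

theorem comp_continuous {φ : β → α} (hf : LocBdd f) (hφ : Continuous φ) :
    LocBdd fun b => f (φ b) := by
  intro K hK
  obtain ⟨C, hC⟩ := hf _ (hK.image hφ)
  exact ⟨C, fun x hx => hC _ (mem_image_of_mem φ hx)⟩

theorem of_abs_le (C : ℝ) (h : ∀ x, |f x| ≤ C) : LocBdd f :=
  fun _ _ => ⟨C, fun x _ => h x⟩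

theorem add (hf : LocBdd f) (hg : LocBdd g) : LocBdd fun x => f x + g x := by
  intro K hK
  obtain ⟨C, hC⟩ := hf K hK
  obtain ⟨D, hD⟩ := hg K hK
  exact ⟨C + D, fun x hx => (abs_add_le _ _).trans (add_le_add (hC x hx) (hD x hx))⟩

theorem mul (hf : LocBdd f) (hg : LocBdd g) : LocBdd fun x => f x * g x := by
  intro K hK
  obtain ⟨C, hC⟩ := hf K hK
  obtain ⟨D, hD⟩ := hg K hK
  refine ⟨C * D, fun x hx => ?_⟩
  rw [abs_mul]
  exact mul_le_mul (hC x hx) (hD x hx) (abs_nonneg _) ((abs_nonneg _).trans (hC x hx))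

theorem integrableOn [MeasurableSpace α] [OpensMeasurableSpace α] [T2Space α]
    {μ : Measure α} [IsFiniteMeasureOnCompacts μ] {K : Set α}
    (hf : LocBdd f) (hm : Measurable f) (hK : IsCompact K) : IntegrableOn f K μ := by
  obtain ⟨C, hC⟩ := hf K hK
  refine Measure.integrableOn_of_bounded (M := C) hK.measure_ne_top hm.aestronglyMeasurable ?_
  exact (ae_restrict_iff' hK.measurableSet).2 (Filter.Eventually.of_forall hC)

theorem intervalIntegrable {f : ℝ → ℝ} (hf : LocBdd f) (hm : Measurable f) (a b : ℝ) :
    IntervalIntegrable f volume a b :=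
  (hf.integrableOn hm isCompact_uIcc).intervalIntegrable

end LocBdd

/-- A bounded solution of a homogeneous linear Volterra inequality vanishes. -/
theorem eq_zero_of_abs_le_abs_integral {k : ℝ → ℝ → ℝ} {d : ℝ → ℝ} {y b C M : ℝ} (hC : 0 ≤ C)
    (hM : ∀ x ∈ Icc y b, |d x| ≤ M)
    (hk : ∀ x ∈ Icc y b, ∀ z ∈ Icc y x, |k x z| ≤ C)
    (hd : ∀ x ∈ Icc y b, |d x| ≤ |∫ z in y..x, k x z * d z|) :
    ∀ x ∈ Icc y b, d x = 0 := by
  have key : ∀ n : ℕ, ∀ x ∈ Icc y b, |d x| ≤ M * ((C * (x - y)) ^ n / n.factorial) := by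
    intro n
    induction n with
    | zero => intro x hx; simpa using hM x hx
    | succ n ih =>
      intro x hx
      have hint : ∫ z in y..x, C * (M * ((C * (z - y)) ^ n / n.factorial))
          = M * ((C * (x - y)) ^ (n + 1) / (n + 1).factorial) := by
        have h1 : ∫ z in y..x, (z - y) ^ n = (x - y) ^ (n + 1) / (n + 1) := by
          rw [intervalIntegral.integral_comp_sub_right (fun z => z ^ n) y, integral_pow]
          simp
        have h2 : (fun z => C * (M * ((C * (z - y)) ^ n / n.factorial)))
            = fun z => C ^ (n + 1) * M / n.factorial * (z - y) ^ n := by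
          funext z; rw [mul_pow]; ring
        rw [h2, intervalIntegral.integral_const_mul, h1, Nat.factorial_succ, mul_pow]
        have := Nat.factorial_ne_zero n
        push_cast
        field_simp
      have hcont : IntervalIntegrable (fun z => C * (M * ((C * (z - y)) ^ n / n.factorial)))
          volume y x := Continuous.intervalIntegrable (by fun_prop) _ _
      rw [← hint]
      refine (hd x hx).trans ?_
      rw [← Real.norm_eq_abs]
      refine intervalIntegral.norm_integral_le_of_norm_le hx.1 ?_ hcont
      refine Filter.Eventually.of_forall fun z hz => ?_
      rw [Real.norm_eq_abs, abs_mul]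
      exact mul_le_mul (hk x hx z ⟨hz.1.le, hz.2⟩) (ih z ⟨hz.1.le, hz.2.trans hx.2⟩)
        (abs_nonneg _) hC
  intro x hx
  have hlim := (FloorSemiring.tendsto_pow_div_factorial_atTop (C * (x - y))).const_mul M
  rw [mul_zero] at hlim
  exact abs_nonpos_iff.1 (ge_of_tendsto' hlim fun n => key n x hx)

/-- Uniqueness of locally bounded solutions of a Volterra equation of convolution type. -/
theorem volterra_unique {W f g h : ℝ → ℝ} {q y b : ℝ}
    (hWm : Measurable W) (hW : LocBdd W) (hfm : Measurable f) (hf : LocBdd f)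
    (hgm : Measurable g) (hg : LocBdd g)
    (hfe : ∀ x ∈ Icc y b, f x = h x + q * ∫ z in y..x, W (x - z) * f z)
    (hge : ∀ x ∈ Icc y b, g x = h x + q * ∫ z in y..x, W (x - z) * g z) :
    ∀ x ∈ Icc y b, f x = g x := by
  obtain ⟨A, hA⟩ := hf (Icc y b) isCompact_Icc
  obtain ⟨B, hB⟩ := hg (Icc y b) isCompact_Icc
  obtain ⟨C, hC⟩ := hW (Icc 0 (b - y)) isCompact_Icc
  have hint : ∀ {u : ℝ → ℝ}, Measurable u → LocBdd u → ∀ x,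
      IntervalIntegrable (fun z => W (x - z) * u z) volume y x := fun hum hu x =>
    ((hW.comp_continuous (by fun_prop : Continuous fun z => x - z)).mul hu).intervalIntegrable
      (by fun_prop) _ _
  have hzero : ∀ x ∈ Icc y b, f x - g x = 0 := by
    refine eq_zero_of_abs_le_abs_integral (k := fun x z => q * W (x - z)) (C := |q| * |C|)
      (M := A + B) (by positivity)
      (fun x hx => (abs_sub _ _).trans (add_le_add (hA x hx) (hB x hx))) ?_ ?_
    · intro x hx z hz
      rw [abs_mul]
      exact mul_le_mul_of_nonneg_left
        ((hC _ ⟨by linarith [hz.2], by linarith [hz.1, hx.2]⟩).trans (le_abs_self C))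
        (abs_nonneg q)
    · intro x hx
      refine le_of_eq (congrArg _ ?_)
      simp only [mul_assoc, mul_sub]
      rw [intervalIntegral.integral_sub ((hint hfm hf x).const_mul q)
        ((hint hgm hg x).const_mul q), intervalIntegral.integral_const_mul,
        intervalIntegral.integral_const_mul, hfe x hx, hge x hx]
      ring
  exact fun x hx => sub_eq_zero.1 (hzero x hx)

/-- An integral against a kernel vanishing on the negative half-line does not see the part of the
interval on which the argument is negative. -/
theorem integral_extend_right {W u : ℝ → ℝ} (hWneg : ∀ x < 0, W x = 0) {y z x : ℝ}
    (hyz : y ≤ z) (hzx : z ≤ x) :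
    ∫ s in y..z, W (z - s) * u s = ∫ s in y..x, W (z - s) * u s := by
  rw [intervalIntegral.integral_of_le hyz, intervalIntegral.integral_of_le (hyz.trans hzx)]
  refine (setIntegral_eq_of_subset_of_forall_sdiff_eq_zero measurableSet_Ioc
    (Ioc_subset_Ioc_right hzx) fun s hs => ?_).symm
  have : z < s := lt_of_not_ge fun h => hs.2 ⟨hs.1.1, h⟩
  rw [hWneg _ (sub_neg.2 this), zero_mul]

theorem integral_extend_left {W u : ℝ → ℝ} (hWneg : ∀ x < 0, W x = 0) {y s x : ℝ}
    (hys : y ≤ s) (hsx : s ≤ x) :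
    ∫ z in s..x, u z * W (z - s) = ∫ z in y..x, u z * W (z - s) := by
  rw [intervalIntegral.integral_of_le hsx, intervalIntegral.integral_of_le (hys.trans hsx),
    ← integral_Icc_eq_integral_Ioc, ← integral_Icc_eq_integral_Ioc]
  refine (setIntegral_eq_of_subset_of_forall_sdiff_eq_zero measurableSet_Icc
    (Icc_subset_Icc_left hys) fun z hz => ?_).symm
  have : z < s := lt_of_not_ge fun h => hz.2 ⟨h, hz.1.2⟩
  rw [hWneg _ (sub_neg.2 this), mul_zero]

/-- The resolvent identity relating the scale functions of two weights. -/
theorem resolvent_identity {W ω ω' : ℝ → ℝ} {U V : ℝ × ℝ → ℝ}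
    (hWm : Measurable W) (hW : LocBdd W) (hWneg : ∀ x < 0, W x = 0)
    (hωm : Measurable ω) (hω : LocBdd ω) (hω'm : Measurable ω') (hω' : LocBdd ω')
    (hUm : Measurable U) (hU : LocBdd U) (hVm : Measurable V) (hV : LocBdd V)
    (hUA : ∀ x y, U (x, y) = W (x - y) + ∫ z in y..x, W (x - z) * ω' z * U (z, y))
    (hVB : ∀ x y, V (x, y) = W (x - y) + ∫ z in y..x, V (x, z) * ω z * W (z - y))
    {x y : ℝ} (hyx : y ≤ x) :
    U (x, y) = V (x, y) + ∫ z in y..x, V (x, z) * (ω' z - ω z) * U (z, y) := by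
  have hWc : ∀ {β : Type} [TopologicalSpace β] {φ : β → ℝ}, Continuous φ →
    LocBdd fun b => W (φ b) := fun h => hW.comp_continuous h
  have hVx : LocBdd fun z => V (x, z) := hV.comp_continuous (by fun_prop)
  have hUy : LocBdd fun z => U (z, y) := hU.comp_continuous (by fun_prop)
  have hVxm : Measurable fun z => V (x, z) := by fun_prop
  have hUym : Measurable fun z => U (z, y) := by fun_prop
  have iVωU : IntervalIntegrable (fun z => V (x, z) * ω z * U (z, y)) volume y x :=
    ((hVx.mul hω).mul hUy).intervalIntegrable (by fun_prop) _ _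
  have iVωW : IntervalIntegrable (fun z => V (x, z) * ω z * W (z - y)) volume y x :=
    ((hVx.mul hω).mul (hWc (by fun_prop))).intervalIntegrable (by fun_prop) _ _
  have iVωU' : IntervalIntegrable (fun z => V (x, z) * ω' z * U (z, y)) volume y x :=
    ((hVx.mul hω').mul hUy).intervalIntegrable (by fun_prop) _ _
  have iWωU' : IntervalIntegrable (fun z => W (x - z) * ω' z * U (z, y)) volume y x :=
    (((hWc (by fun_prop)).mul hω').mul hUy).intervalIntegrable (by fun_prop) _ _
  let F : ℝ → ℝ → ℝ := fun z s => V (x, z) * ω z * W (z - s) * (ω' s * U (s, y))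
  have hFm : Measurable (Function.uncurry F) := by
    simp only [F, Function.uncurry_def]; fun_prop
  have hF : LocBdd (Function.uncurry F) :=
    (((hVx.comp_continuous continuous_fst).mul (hω.comp_continuous continuous_fst)).mul
      (hWc (by fun_prop))).mul
      ((hω'.comp_continuous continuous_snd).mul (hUy.comp_continuous continuous_snd))
  have hswap : ∫ z in y..x, ∫ s in y..x, F z s = ∫ s in y..x, ∫ z in y..x, F z s := by
    simp only [intervalIntegral.integral_of_le hyx]
    refine integral_integral_swap ?_
    rw [Measure.prod_restrict]
    exact (hF.integrableOn hFm (isCompact_Icc.prod isCompact_Icc)).mono_set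
      (prod_mono Ioc_subset_Icc_self Ioc_subset_Icc_self)
  have hleft : ∀ z ∈ uIcc y x,
      ∫ s in y..x, F z s = V (x, z) * ω z * U (z, y) - V (x, z) * ω z * W (z - y) := by
    intro z hz
    rw [uIcc_of_le hyx] at hz
    have h := hUA z y
    simp only [mul_assoc (W _)] at h
    rw [integral_extend_right (u := fun s => ω' s * U (s, y)) hWneg hz.1 hz.2] at h
    simp only [F, mul_assoc (V (x, z) * ω z), intervalIntegral.integral_const_mul]
    rw [h]; ring
  have hright : ∀ s ∈ uIcc y x,
      ∫ z in y..x, F z s = V (x, s) * ω' s * U (s, y) - W (x - s) * ω' s * U (s, y) := by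
    intro s hs
    rw [uIcc_of_le hyx] at hs
    have h := hVB x s
    rw [integral_extend_left (u := fun z => V (x, z) * ω z) hWneg hs.1 hs.2] at h
    simp only [F, intervalIntegral.integral_mul_const]
    rw [h]; ring
  rw [intervalIntegral.integral_congr hleft, intervalIntegral.integral_congr hright,
    intervalIntegral.integral_sub iVωU iVωW, intervalIntegral.integral_sub iVωU' iWωU'] at hswap
  have hsplit : ∫ z in y..x, V (x, z) * (ω' z - ω z) * U (z, y)
      = (∫ z in y..x, V (x, z) * ω' z * U (z, y)) - ∫ z in y..x, V (x, z) * ω z * U (z, y) := by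
    rw [← intervalIntegral.integral_sub iVωU' iVωU]
    congr 1; funext z; ring
  rw [hsplit]
  linarith [hUA x y, hVB x y]

/-- Where the weight is constantly `q`, its scale function is a translate of the `q`-scale
function. -/
theorem eq_scale_of_weight_eq_const {W Q ω : ℝ → ℝ} {U : ℝ × ℝ → ℝ} {q : ℝ}
    (hWm : Measurable W) (hW : LocBdd W)
    (hQm : Measurable Q) (hQ : LocBdd Q)
    (hQe : ∀ x, Q x = W x + q * ∫ z in (0 : ℝ)..x, W (x - z) * Q z)
    (hUm : Measurable U) (hU : LocBdd U)
    (hUA : ∀ x y, U (x, y) = W (x - y) + ∫ z in y..x, W (x - z) * ω z * U (z, y))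
    {x y : ℝ} (hyx : y ≤ x) (hω : ∀ z < x, ω z = q) :
    U (x, y) = Q (x - y) := by
  refine volterra_unique (f := fun x => U (x, y)) (g := fun x => Q (x - y))
    (h := fun x => W (x - y)) (q := q) hWm hW (by fun_prop)
    (hU.comp_continuous (by fun_prop)) (by fun_prop) (hQ.comp_continuous (by fun_prop))
    ?_ ?_ x (right_mem_Icc.2 hyx)
  · intro t ht
    rw [hUA t y, ← intervalIntegral.integral_const_mul]
    congr 1
    rw [intervalIntegral.integral_of_le ht.1, intervalIntegral.integral_of_le ht.1,
      integral_Ioc_eq_integral_Ioo, integral_Ioc_eq_integral_Ioo]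
    refine setIntegral_congr_fun measurableSet_Ioo fun z hz => ?_
    rw [hω z (hz.2.trans_le ht.2)]; ring
  · intro t ht
    have h := intervalIntegral.integral_comp_sub_right
      (fun z => W (t - y - z) * Q z) y (a := y) (b := t)
    simp only [sub_self, sub_sub_sub_cancel_right] at h
    simp only [h]
    exact hQe _

/-- A solution of equation (A) vanishes below the diagonal. -/
theorem eq_zero_of_lt {W ω : ℝ → ℝ} {U : ℝ × ℝ → ℝ} (hWneg : ∀ x < 0, W x = 0)
    (hUA : ∀ x y, U (x, y) = W (x - y) + ∫ z in y..x, W (x - z) * ω z * U (z, y))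
    {x y : ℝ} (hxy : x < y) : U (x, y) = 0 := by
  rw [hUA, hWneg _ (sub_neg.2 hxy), intervalIntegral.integral_symm,
    intervalIntegral.integral_of_le hxy.le,
    setIntegral_eq_zero_of_forall_eq_zero fun z hz => ?_]
  · simp
  · rw [hWneg _ (sub_neg.2 hz.1)]; ring

/-- Proposition 4, first part: the recursion for `W_n`. -/
theorem statement9
    (W : ℝ → ℝ)
    (hWmeas : Measurable W) (hWbdd : LocBdd W) (hWneg : ∀ x : ℝ, x < 0 → W x = 0)
    -- the family of `q`-scale functions `W^{(q)}` for `q ≥ 0`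
    (Wq : ℝ → ℝ → ℝ)
    (hWqmeas : ∀ q : ℝ, 0 ≤ q → Measurable (Wq q))
    (hWqbdd : ∀ q : ℝ, 0 ≤ q → LocBdd (Wq q))
    (hWqneg : ∀ q : ℝ, 0 ≤ q → ∀ x : ℝ, x < 0 → Wq q x = 0)
    (hWqeq : ∀ q : ℝ, 0 ≤ q →
      ∀ x : ℝ, Wq q x = W x + q * ∫ z in (0 : ℝ)..x, W (x - z) * Wq q z)
    -- the partition points and levels
    (a : ℕ → ℝ) (ha : ∀ k : ℕ, 1 ≤ k → a (k + 1) < a k)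
    (p : ℕ → ℝ) (hp : ∀ k : ℕ, 0 ≤ p k)
    -- the step weight functions `ω_n`
    (ωn : ℕ → ℝ → ℝ)
    (hω0 : ∀ x : ℝ, ωn 0 x = p 0)
    (hωs : ∀ n : ℕ, 1 ≤ n → ∀ x : ℝ, ωn n x =
      (if a 1 ≤ x then p 0 else 0)
        + (∑ k ∈ Finset.Icc 1 (n - 1), if a (k + 1) ≤ x ∧ x < a k then p k else 0)
        + (if x < a n then p n else 0))
    -- the `ω_n`-scale functions `W_n`, solutions of both equations (A) and (B)
    (Wn : ℕ → ℝ × ℝ → ℝ)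
    (hWnmeas : ∀ n : ℕ, Measurable (Wn n)) (hWnbdd : ∀ n : ℕ, LocBdd (Wn n))
    (hWnA : ∀ n : ℕ, ∀ x y : ℝ,
      Wn n (x, y) = W (x - y) + ∫ z in y..x, W (x - z) * ωn n z * Wn n (z, y))
    (hWnB : ∀ n : ℕ, ∀ x y : ℝ,
      Wn n (x, y) = W (x - y) + ∫ z in y..x, Wn n (x, z) * ωn n z * W (z - y)) :
    (∀ x y : ℝ, Wn 0 (x, y) = Wq (p 0) (x - y)) ∧
    (∀ n : ℕ, ∀ x y : ℝ, y ≤ x →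
      Wn (n + 1) (x, y)
        = Wn n (x, y)
          + (p (n + 1) - p n) * ∫ z in y..(a (n + 1)), Wn n (x, z) * Wq (p (n + 1)) (z - y)) := by
  have hstep : ∀ n x, ωn (n + 1) x
      = ωn n x + (p (n + 1) - p n) * (Iio (a (n + 1))).indicator 1 x := by
    intro n x
    rcases n with _ | n
    · rw [hω0, hωs 1 le_rfl]
      rcases lt_or_ge x (a 1) with h | h
      · simp [h, h.not_ge]
      · simp [h, h.not_gt]
    · rw [hωs (n + 2) (by omega), hωs (n + 1) (by omega)]
      simp only [Nat.add_sub_cancel, show n + 2 - 1 = n + 1 from rfl]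
      rw [Finset.sum_Icc_succ_top (by omega)]
      have hlt := ha (n + 1) (by omega)
      simp only [indicator_apply, mem_Iio, Pi.one_apply]
      rcases lt_or_ge x (a (n + 2)) with h | h
      · have h' := h.trans hlt
        simp only [h, h', h.not_ge, if_true, false_and, if_false]
        ring
      · rcases lt_or_ge x (a (n + 1)) with h' | h'
        · simp only [h, h', h.not_gt, and_self, if_true, if_false]
          ring
        · simp only [h, h'.not_gt, h.not_gt, and_false, if_false]
          ring
  have hωreg : ∀ n, Measurable (ωn n) ∧ LocBdd (ωn n) := by
    intro n
    induction n with
    | zero =>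
      rw [show ωn 0 = fun _ => p 0 from funext hω0]
      exact ⟨measurable_const, LocBdd.of_abs_le _ fun _ => le_rfl⟩
    | succ n ih =>
      rw [show ωn (n + 1) = _ from funext (hstep n)]
      refine ⟨ih.1.add ((measurable_one.indicator measurableSet_Iio).const_mul _),
        ih.2.add (LocBdd.mul (LocBdd.of_abs_le _ fun _ => le_rfl) (LocBdd.of_abs_le 1 fun x => ?_))⟩
      by_cases h : x ∈ Iio (a (n + 1)) <;> simp [h]
  have hωlow : ∀ n, ∀ x < a (n + 1), ωn (n + 1) x = p (n + 1) := by
    intro n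
    induction n with
    | zero =>
      intro x hx
      rw [hstep, hω0, indicator_of_mem (mem_Iio.2 hx), Pi.one_apply]
      ring
    | succ n ih =>
      intro x hx
      rw [hstep, ih x (hx.trans (ha (n + 1) (by omega))), indicator_of_mem (mem_Iio.2 hx),
        Pi.one_apply]
      ring
  have hQ : ∀ n x y, y ≤ x → (∀ z < x, ωn n z = p n) → Wn n (x, y) = Wq (p n) (x - y) :=
    fun n x y hyx hω => eq_scale_of_weight_eq_const hWmeas hWbdd (hWqmeas _ (hp n))
      (hWqbdd _ (hp n)) (hWqeq _ (hp n)) (hWnmeas n) (hWnbdd n) (hWnA n) hyx hω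
  refine ⟨fun x y => ?_, fun n x y hyx => ?_⟩
  · rcases le_or_gt y x with h | h
    · exact hQ 0 x y h fun z _ => hω0 z
    · rw [eq_zero_of_lt hWneg (hWnA 0) h, hWqneg _ (hp 0) _ (sub_neg.2 h)]
  · rw [resolvent_identity hWmeas hWbdd hWneg (hωreg n).1 (hωreg n).2 (hωreg (n + 1)).1
      (hωreg (n + 1)).2 (hWnmeas (n + 1)) (hWnbdd (n + 1)) (hWnmeas n) (hWnbdd n) (hWnA (n + 1))
      (hWnB n) hyx]
    congr 1
    rw [intervalIntegral.integral_of_le hyx]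
    rcases le_or_gt (a (n + 1)) y with hay | hay
    · rw [intervalIntegral.integral_symm, intervalIntegral.integral_of_le hay,
        integral_Ioc_eq_integral_Ioo (x := a (n + 1)),
        setIntegral_eq_zero_of_forall_eq_zero (t := Ioo _ _) fun z hz => ?_,
        setIntegral_eq_zero_of_forall_eq_zero fun z hz => ?_]
      · simp
      · rw [hstep, indicator_of_notMem (notMem_Iio.2 (hay.trans hz.1.le))]; ring
      · rw [hWqneg _ (hp _) _ (sub_neg.2 hz.2), mul_zero]
    · rw [intervalIntegral.integral_of_le hay.le, ← integral_const_mul,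
        setIntegral_eq_of_subset_of_forall_sdiff_eq_zero measurableSet_Ioc
          (Ioc_subset_Ioc_right (min_le_left x (a (n + 1)))) fun z hz => ?_,
        setIntegral_eq_of_subset_of_forall_sdiff_eq_zero (t := Ioc y (a (n + 1))) measurableSet_Ioc
          (Ioc_subset_Ioc_right (min_le_right x (a (n + 1)))) fun z hz => ?_,
        integral_Ioc_eq_integral_Ioo, integral_Ioc_eq_integral_Ioo]
      · refine setIntegral_congr_fun measurableSet_Ioo fun z hz => ?_
        have hza : z < a (n + 1) := hz.2.trans_le (min_le_right _ _)
        rw [hQ (n + 1) z y hz.1.le fun t ht => hωlow n t (ht.trans hza), hstep,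
          indicator_of_mem (mem_Iio.2 hza), Pi.one_apply]
        ring
      · have hxz : x < z := lt_of_not_ge fun h => hz.2 ⟨hz.1.1, le_min h hz.1.2⟩
        rw [eq_zero_of_lt hWneg (hWnA n) hxz]; ring
      · have haz : a (n + 1) < z := lt_of_not_ge fun h => hz.2 ⟨hz.1.1, le_min hz.1.2 h⟩
        rw [hstep, indicator_of_notMem (notMem_Iio.2 haz.le)]; ring
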